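/- A Γ-group G has a universal central Γ-equivariant extension if and only if G is Γ-perfect. -/

import Mathlib

/-- The Γ-commutator subgroup `[G,G]_Γ` of a Γ-group `G`: the subgroup generated by all
commutators together with the elements `(σ • g) * g⁻¹`. -/
def gammaCommutator (Γ G : Type*) [Group Γ] [Group G] [MulDistribMulAction Γ G] : Subgroup G :=
  Subgroup.closure ({x | ∃ a b : G, x = a * b * a⁻¹ * b⁻¹} ∪
    {x | ∃ (σ : Γ) (g : G), x = σ • g * g⁻¹})

instance gammaCommutator_normal (Γ G : Type*) [Group Γ] [Group G] [MulDistribMulAction Γ G] :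
    (gammaCommutator Γ G).Normal := by
  constructor
  intro n hn g
  have h1 : g * n * g⁻¹ * n⁻¹ ∈ gammaCommutator Γ G :=
    Subgroup.subset_closure (Or.inl ⟨g, n, rfl⟩)
  have h2 := mul_mem h1 hn
  simpa [mul_assoc] using h2

theorem gammaCommutator_smul_mem {Γ G : Type*} [Group Γ] [Group G] [MulDistribMulAction Γ G]
    (σ : Γ) {x : G} (hx : x ∈ gammaCommutator Γ G) : σ • x ∈ gammaCommutator Γ G := by
  induction hx using Subgroup.closure_induction with
  | mem y hy =>
    rcases hy with ⟨a, b, rfl⟩ | ⟨τ, g, rfl⟩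
    · refine Subgroup.subset_closure (Or.inl ⟨σ • a, σ • b, ?_⟩)
      simp [smul_mul', smul_inv']
    · refine Subgroup.subset_closure (Or.inr ⟨σ * τ * σ⁻¹, σ • g, ?_⟩)
      rw [smul_mul', smul_inv', ← mul_smul, ← mul_smul]
      simp [mul_assoc]
  | one => simpa using one_mem (gammaCommutator Γ G)
  | mul a b _ _ iha ihb => rw [smul_mul']; exact mul_mem iha ihb
  | inv a _ iha => rw [smul_inv']; exact inv_mem iha

instance gammaCommutatorAction (Γ G : Type*) [Group Γ] [Group G] [MulDistribMulAction Γ G] :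
    MulDistribMulAction Γ (gammaCommutator Γ G) where
  smul σ x := ⟨σ • (x : G), gammaCommutator_smul_mem σ x.2⟩
  one_smul x := Subtype.ext (one_smul Γ (x : G))
  mul_smul σ τ x := Subtype.ext (mul_smul σ τ (x : G))
  smul_mul σ x y := Subtype.ext (smul_mul' σ (x : G) (y : G))
  smul_one σ := Subtype.ext (smul_one σ)

instance gammaAbelianization_commGroup (Γ G : Type*) [Group Γ] [Group G]
    [MulDistribMulAction Γ G] : CommGroup (G ⧸ gammaCommutator Γ G) where
  mul_comm a b := by
    induction a using QuotientGroup.induction_on with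
    | _ x =>
    induction b using QuotientGroup.induction_on with
    | _ y =>
    rw [← QuotientGroup.mk_mul, ← QuotientGroup.mk_mul, QuotientGroup.eq]
    exact Subgroup.subset_closure (Or.inl ⟨y⁻¹, x⁻¹, by group⟩)

universe u v

/-- `φ : B →* G` is a central Γ-equivariant extension of the Γ-group `G`. -/
def IsCentralGammaExt (Γ : Type u) [Group Γ] {B G : Type v} [Group B] [Group G]
    [MulDistribMulAction Γ B] [MulDistribMulAction Γ G] (φ : B →* G) : Prop :=
  (∀ (σ : Γ) (b : B), φ (σ • b) = σ • φ b) ∧ Function.Surjective φ ∧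
    φ.ker ≤ Subgroup.center B ∧ (∀ (σ : Γ), ∀ b ∈ φ.ker, σ • b = b) ∧
    ∃ γ : G → B, (∀ (σ : Γ) (g : G), γ (σ • g) = σ • γ g) ∧ ∀ g, φ (γ g) = g

/-- A central Γ-equivariant extension `β : U →* G` is universal if for every central
Γ-equivariant extension `α : X →* G` there is a unique Γ-homomorphism `U →* X` over `G`. -/
def IsUniversalCentralGammaExt (Γ : Type u) [Group Γ] {U G : Type v} [Group U] [Group G]
    [MulDistribMulAction Γ U] [MulDistribMulAction Γ G] (β : U →* G) : Prop :=
  IsCentralGammaExt Γ β ∧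
    ∀ (X : Type v) [Group X] [MulDistribMulAction Γ X] (α : X →* G),
      IsCentralGammaExt Γ α →
        ∃! f : U →* X, (∀ (σ : Γ) (u : U), f (σ • u) = σ • f u) ∧ α.comp f = β

/-- A bundled universal central Γ-equivariant extension of the Γ-group `G`. -/
structure UniversalCentralGammaExtension (Γ : Type u) [Group Γ] (G : Type v) [Group G]
    [MulDistribMulAction Γ G] where
  U : Type v
  [instGroup : Group U]
  [instAction : MulDistribMulAction Γ U]
  β : U →* G
  universal : IsUniversalCentralGammaExt Γ β

section HomDiff

variable {Γ : Type*} [Group Γ] {U B G : Type*} [Group U] [Group B] [Group G]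
  [MulDistribMulAction Γ U] [MulDistribMulAction Γ B]

/-- Two Γ-homomorphisms into a central extension with trivial Γ-action on the kernel agree on the
Γ-commutator subgroup as soon as they agree over the base. -/
theorem gammaCommutator_le_eqLocus {φ : B →* G} (hc : φ.ker ≤ Subgroup.center B)
    (ht : ∀ (σ : Γ), ∀ b ∈ φ.ker, σ • b = b) {f f' : U →* B}
    (hf : ∀ (σ : Γ) (u : U), f (σ • u) = σ • f u)
    (hf' : ∀ (σ : Γ) (u : U), f' (σ • u) = σ • f' u)
    (h : φ.comp f = φ.comp f') : gammaCommutator Γ U ≤ f.eqLocus f' := by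
  have key : ∀ u, ∃ z ∈ φ.ker, f u = f' u * z := fun u =>
    ⟨(f' u)⁻¹ * f u, by
      have := DFunLike.congr_fun h u
      simp only [MonoidHom.comp_apply] at this
      simp [MonoidHom.mem_ker, this], by group⟩
  refine (Subgroup.closure_le _).2 ?_
  rintro x (⟨a, b, rfl⟩ | ⟨σ, g, rfl⟩)
  · obtain ⟨z, hz, ha⟩ := key a
    obtain ⟨w, hw, hb⟩ := key b
    have hz' := Subgroup.mem_center_iff.1 (hc hz)
    have hw' := Subgroup.mem_center_iff.1 (hc hw)
    change f (a * b * a⁻¹ * b⁻¹) = f' (a * b * a⁻¹ * b⁻¹)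
    simp only [map_mul, map_inv, ha, hb]
    calc f' a * z * (f' b * w) * (f' a * z)⁻¹ * (f' b * w)⁻¹
        = f' a * (z * (f' b * w)) * (z⁻¹ * (f' a)⁻¹) * (w⁻¹ * (f' b)⁻¹) := by group
      _ = f' a * f' b * (w * (f' a)⁻¹) * (w⁻¹ * (f' b)⁻¹) := by rw [← hz']; group
      _ = f' a * f' b * (f' a)⁻¹ * (f' b)⁻¹ := by rw [← hw']; group
  · obtain ⟨z, hz, hg⟩ := key g
    change f (σ • g * g⁻¹) = f' (σ • g * g⁻¹)
    simp only [map_mul, map_inv, hf, hf', hg, smul_mul', ht σ z hz]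
    group

end HomDiff

section Perfect

variable {Γ : Type*} [Group Γ] {B G : Type*} [Group B] [Group G] [MulDistribMulAction Γ B]

theorem coe_smul_gammaCommutator (σ : Γ) (x : gammaCommutator Γ B) :
    ((σ • x : gammaCommutator Γ B) : B) = σ • (x : B) := rfl

/-- If `φ` has central kernel with trivial Γ-action and already the Γ-commutator subgroup of `B`
surjects onto `G`, then that subgroup is Γ-perfect. -/
theorem gammaCommutator_gammaCommutator_eq_top {φ : B →* G} (hc : φ.ker ≤ Subgroup.center B)
    (ht : ∀ (σ : Γ), ∀ b ∈ φ.ker, σ • b = b)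
    (hs : ∀ g, ∃ p ∈ gammaCommutator Γ B, φ p = g) :
    gammaCommutator Γ (gammaCommutator Γ B) = ⊤ := by
  have key : ∀ b : B, ∃ (p : gammaCommutator Γ B), ∃ z ∈ φ.ker, b = p * z := fun b => by
    obtain ⟨p, hp, hb⟩ := hs (φ b)
    exact ⟨⟨p, hp⟩, p⁻¹ * b, by simp [MonoidHom.mem_ker, hb], by simp⟩
  have le : gammaCommutator Γ B ≤
      (gammaCommutator Γ (gammaCommutator Γ B)).map (gammaCommutator Γ B).subtype := by
    conv_lhs => rw [gammaCommutator]
    refine (Subgroup.closure_le _).2 ?_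
    rintro x (⟨a, b, rfl⟩ | ⟨σ, g, rfl⟩)
    · obtain ⟨p, z, hz, rfl⟩ := key a
      obtain ⟨q, w, hw, rfl⟩ := key b
      have hz' := Subgroup.mem_center_iff.1 (hc hz)
      have hw' := Subgroup.mem_center_iff.1 (hc hw)
      refine ⟨p * q * p⁻¹ * q⁻¹, Subgroup.subset_closure (Or.inl ⟨p, q, rfl⟩), ?_⟩
      symm
      simp only [map_mul, map_inv, Subgroup.coe_subtype]
      calc (p * z * (q * w) * (p * z)⁻¹ * (q * w)⁻¹ : B)
          = p * (z * (q * w)) * (z⁻¹ * (p : B)⁻¹) * (w⁻¹ * (q : B)⁻¹) := by group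
        _ = p * q * (w * (p : B)⁻¹) * (w⁻¹ * (q : B)⁻¹) := by rw [← hz']; group
        _ = p * q * (p : B)⁻¹ * (q : B)⁻¹ := by rw [← hw']; group
    · obtain ⟨p, z, hz, rfl⟩ := key g
      refine ⟨σ • p * p⁻¹, Subgroup.subset_closure (Or.inr ⟨σ, p, rfl⟩), ?_⟩
      simp only [map_mul, map_inv, Subgroup.coe_subtype, smul_mul', ht σ z hz,
        coe_smul_gammaCommutator]
      group
  refine eq_top_iff.2 fun x _ => ?_
  obtain ⟨y, hy, hyx⟩ := le x.2
  rwa [← Subtype.ext hyx]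

end Perfect

section CentralQuotient

variable {Γ : Type*} [Group Γ] {F G : Type*} [Group F] [Group G] [MulDistribMulAction Γ F]

/-- The smallest normal subgroup of `F` modulo which the kernel of `π` is central with trivial
Γ-action. -/
def kerGammaCommutator (Γ : Type*) [Group Γ] {F G : Type*} [Group F] [Group G]
    [MulDistribMulAction Γ F] (π : F →* G) : Subgroup F :=
  Subgroup.normalClosure ({x | ∃ r ∈ π.ker, ∃ f : F, x = f * r * f⁻¹ * r⁻¹} ∪
    {x | ∃ σ : Γ, ∃ r ∈ π.ker, x = σ • r * r⁻¹})

instance kerGammaCommutator_normal (π : F →* G) : (kerGammaCommutator Γ π).Normal :=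
  Subgroup.normalClosure_normal

/-- A Γ-homomorphism over `G` into an extension with central kernel and trivial Γ-action on the
kernel is trivial on `kerGammaCommutator`. -/
theorem kerGammaCommutator_le_ker {B : Type*} [Group B] [MulDistribMulAction Γ B] {π : F →* G}
    {φ : B →* G} (hc : φ.ker ≤ Subgroup.center B) (ht : ∀ (σ : Γ), ∀ b ∈ φ.ker, σ • b = b)
    {f : F →* B} (hf : ∀ (σ : Γ) (x : F), f (σ • x) = σ • f x) (h : φ.comp f = π) :
    kerGammaCommutator Γ π ≤ f.ker := by
  subst h
  refine Subgroup.normalClosure_le_normal ?_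
  rintro x (⟨r, hr, y, rfl⟩ | ⟨σ, r, hr, rfl⟩)
  · have hr' := Subgroup.mem_center_iff.1 (hc (show f r ∈ φ.ker from hr))
    change f _ = 1
    simp [hr']
  · change f _ = 1
    simp [hf, ht σ (f r) hr]

variable [MulDistribMulAction Γ G]

theorem kerGammaCommutator_le_base_ker {π : F →* G} (hπ : ∀ (σ : Γ) (x : F), π (σ • x) = σ • π x) :
    kerGammaCommutator Γ π ≤ π.ker :=
  kerGammaCommutator_le_ker (φ := MonoidHom.id G) (by simp [MonoidHom.ker_id])
    (fun σ b hb => by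
      obtain rfl : b = 1 := hb
      exact smul_one σ) hπ rfl

theorem kerGammaCommutator_le_comap_smul {π : F →* G}
    (hπ : ∀ (σ : Γ) (x : F), π (σ • x) = σ • π x) (σ : Γ) :
    kerGammaCommutator Γ π ≤
      (kerGammaCommutator Γ π).comap (MulDistribMulAction.toMonoidHom F σ) := by
  have hker : ∀ r ∈ π.ker, σ • r ∈ π.ker := fun r hr => by
    rw [MonoidHom.mem_ker] at hr ⊢
    rw [hπ, hr, smul_one]
  conv_lhs => rw [kerGammaCommutator]
  refine Subgroup.normalClosure_le_normal ?_
  rintro x (⟨r, hr, y, rfl⟩ | ⟨τ, r, hr, rfl⟩)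
  · exact Subgroup.subset_normalClosure (Or.inl ⟨σ • r, hker r hr, σ • y, by
      simp [smul_mul', smul_inv']⟩)
  · exact Subgroup.subset_normalClosure (Or.inr ⟨σ * τ * σ⁻¹, σ • r, hker r hr, by
      simp [smul_mul', smul_inv', ← mul_smul]⟩)

/-- The Γ-action on the quotient by `kerGammaCommutator`. -/
abbrev kerGammaCommutatorQuotientAction {π : F →* G}
    (hπ : ∀ (σ : Γ) (x : F), π (σ • x) = σ • π x) :
    MulDistribMulAction Γ (F ⧸ kerGammaCommutator Γ π) where
  smul σ := QuotientGroup.map _ _ _ (kerGammaCommutator_le_comap_smul hπ σ)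
  one_smul x := by
    induction x using QuotientGroup.induction_on with
    | _ x => exact congrArg QuotientGroup.mk (one_smul Γ x)
  mul_smul σ τ x := by
    induction x using QuotientGroup.induction_on with
    | _ x => exact congrArg QuotientGroup.mk (mul_smul σ τ x)
  smul_mul σ x y := map_mul (QuotientGroup.map _ _ _ (kerGammaCommutator_le_comap_smul hπ σ)) x y
  smul_one σ := map_one (QuotientGroup.map _ _ _ (kerGammaCommutator_le_comap_smul hπ σ))

end CentralQuotient

/-- The action of `Γ` on the free group on a Γ-set, permuting the generators. -/
abbrev freeGroupAction (Γ X : Type*) [Group Γ] [MulAction Γ X] :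
    MulDistribMulAction Γ (FreeGroup X) where
  smul σ := FreeGroup.map (σ • ·)
  one_smul x := by
    change FreeGroup.map (fun y : X => (1 : Γ) • y) x = x
    simp
  mul_smul σ τ x := by
    change FreeGroup.map (fun y : X => (σ * τ) • y) x =
      FreeGroup.map (σ • ·) (FreeGroup.map (τ • ·) x)
    rw [FreeGroup.map.comp]
    simp only [mul_smul]
    rfl
  smul_mul σ x y := map_mul (FreeGroup.map (σ • ·)) x y
  smul_one σ := map_one (FreeGroup.map (σ • ·))

section Existence

variable (Γ : Type u) [Group Γ] (G : Type v) [Group G] [MulDistribMulAction Γ G]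

attribute [local instance] freeGroupAction

theorem freeGroup_lift_smul {B : Type*} [Group B] [MulDistribMulAction Γ B] {γ : G → B}
    (hγ : ∀ (σ : Γ) (g : G), γ (σ • g) = σ • γ g) (σ : Γ) (x : FreeGroup G) :
    FreeGroup.lift γ (σ • x) = σ • FreeGroup.lift γ x := by
  have : (FreeGroup.lift γ).comp (MulDistribMulAction.toMonoidHom (FreeGroup G) σ) =
      (MulDistribMulAction.toMonoidHom B σ).comp (FreeGroup.lift γ) := by
    ext g
    change FreeGroup.lift γ (FreeGroup.map (σ • ·) (FreeGroup.of g)) =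
      σ • FreeGroup.lift γ (FreeGroup.of g)
    simp [hγ]
  exact DFunLike.congr_fun this x

/-- Every Γ-group has a weakly universal central Γ-equivariant extension. -/
theorem exists_weaklyUniversalCentralGammaExt :
    ∃ (B : Type v) (_ : Group B) (_ : MulDistribMulAction Γ B) (φ : B →* G),
      IsCentralGammaExt Γ φ ∧
        ∀ (X : Type v) [Group X] [MulDistribMulAction Γ X] (α : X →* G),
          IsCentralGammaExt Γ α →
            ∃ f : B →* X, (∀ (σ : Γ) (b : B), f (σ • b) = σ • f b) ∧ α.comp f = φ := by
  let π : FreeGroup G →* G := FreeGroup.lift id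
  have hπ : ∀ (σ : Γ) (x : FreeGroup G), π (σ • x) = σ • π x :=
    freeGroup_lift_smul Γ G fun _ _ => rfl
  let act := kerGammaCommutatorQuotientAction hπ
  have mk_smul : ∀ (σ : Γ) (x : FreeGroup G),
      σ • (x : FreeGroup G ⧸ kerGammaCommutator Γ π) = ((σ • x : FreeGroup G) : _) :=
    fun _ _ => rfl
  have mk_eq_one : ∀ {x : FreeGroup G}, x ∈ kerGammaCommutator Γ π →
      (x : FreeGroup G ⧸ kerGammaCommutator Γ π) = 1 := fun hx => (QuotientGroup.eq_one_iff _).2 hx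
  refine ⟨FreeGroup G ⧸ kerGammaCommutator Γ π, inferInstance, act,
    QuotientGroup.lift _ π (kerGammaCommutator_le_base_ker hπ),
    ⟨?_, ?_, ?_, ?_, fun g => (FreeGroup.of g : FreeGroup G), ?_, ?_⟩, ?_⟩
  · intro σ b
    induction b using QuotientGroup.induction_on with
    | _ x => exact hπ σ x
  · intro g
    exact ⟨(FreeGroup.of g : FreeGroup G), FreeGroup.lift_apply_of⟩
  · intro b hb
    rw [Subgroup.mem_center_iff]
    intro c
    induction b using QuotientGroup.induction_on with
    | _ x =>
    induction c using QuotientGroup.induction_on with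
    | _ y =>
    have := mk_eq_one (Subgroup.subset_normalClosure (Or.inl ⟨x, hb, y, rfl⟩))
    simp only [QuotientGroup.mk_mul, QuotientGroup.mk_inv] at this
    exact mul_inv_eq_iff_eq_mul.1 (mul_inv_eq_one.1 this)
  · intro σ b hb
    induction b using QuotientGroup.induction_on with
    | _ x =>
    have := mk_eq_one (Subgroup.subset_normalClosure (Or.inr ⟨σ, x, hb, rfl⟩))
    simp only [QuotientGroup.mk_mul, QuotientGroup.mk_inv] at this
    exact mul_inv_eq_one.1 this
  · intro σ g
    rw [mk_smul]
    exact congrArg QuotientGroup.mk (FreeGroup.map.of (f := fun y : G => σ • y)).symm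
  · intro g
    exact FreeGroup.lift_apply_of
  · rintro X _ _ α ⟨-, -, hc, ht, γ, hγ, hαγ⟩
    have hf := freeGroup_lift_smul Γ G hγ
    have hcomp : α.comp (FreeGroup.lift γ) = π := by
      ext g
      simp [π, hαγ]
    refine ⟨QuotientGroup.lift _ (FreeGroup.lift γ) (kerGammaCommutator_le_ker hc ht hf hcomp),
      ?_, ?_⟩
    · intro σ b
      induction b using QuotientGroup.induction_on with
      | _ x => exact hf σ x
    · ext x
      simpa using DFunLike.congr_fun hcomp (FreeGroup.of x)

end Existence

/-- The Γ-commutator subgroup of a central Γ-equivariant extension is again a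
central Γ-equivariant extension, provided it surjects onto the base. -/
theorem IsCentralGammaExt.comp_subtype {Γ : Type u} [Group Γ] {B G : Type v} [Group B] [Group G]
    [MulDistribMulAction Γ B] [MulDistribMulAction Γ G] {φ : B →* G} (h : IsCentralGammaExt Γ φ)
    (hs : ∀ g, ∃ p ∈ gammaCommutator Γ B, φ p = g) :
    IsCentralGammaExt Γ (φ.comp (gammaCommutator Γ B).subtype) := by
  obtain ⟨hφ, -, hc, ht, γ, hγ, hφγ⟩ := h
  choose p hp hφp using hs
  let rep : G → G := fun g => (Quotient.mk (MulAction.orbitRel Γ G) g).out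
  have hrep : ∀ g, ∃ σ : Γ, g = σ • rep g := fun g => by
    obtain ⟨σ, hσ⟩ := (MulAction.orbitRel Γ G).symm (Quotient.mk_out g)
    exact ⟨σ, hσ.symm⟩
  have rep_smul : ∀ (σ : Γ) (g : G), rep (σ • g) = rep g := fun σ g =>
    congrArg Quotient.out (Quotient.sound ⟨σ, rfl⟩)
  let z : G → B := fun g => (γ (rep g))⁻¹ * p (rep g)
  have hz : ∀ g, z g ∈ φ.ker := fun g => by simp [z, MonoidHom.mem_ker, hφγ, hφp]
  have z_smul : ∀ (σ : Γ) (g : G), z (σ • g) = z g := fun σ g => by simp only [z, rep_smul]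
  have mem : ∀ g, γ g * z g ∈ gammaCommutator Γ B := fun g => by
    obtain ⟨σ, hσ⟩ := hrep g
    have : γ g * z g = σ • p (rep g) := by
      conv_lhs => rw [← ht σ _ (hz g)]
      nth_rw 1 [hσ]
      rw [hγ, ← smul_mul']
      simp [z]
    rw [this]
    exact gammaCommutator_smul_mem σ (hp _)
  refine ⟨fun σ b => hφ σ b, fun g => ⟨⟨p g, hp g⟩, hφp g⟩, fun b hb => ?_,
    fun σ b hb => Subtype.ext (ht σ b hb), fun g => ⟨γ g * z g, mem g⟩, fun σ g => ?_,
    fun g => ?_⟩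
  · rw [Subgroup.mem_center_iff]
    exact fun c => Subtype.ext (Subgroup.mem_center_iff.1 (hc (show (b : B) ∈ φ.ker from hb)) c)
  · refine Subtype.ext ?_
    change γ (σ • g) * z (σ • g) = σ • (γ g * z g)
    rw [z_smul, hγ, smul_mul', ht σ _ (hz g)]
  · change φ (γ g * z g) = g
    rw [map_mul, hφγ, (hz g : φ (z g) = 1), mul_one]

/-- A surjective Γ-homomorphism maps the Γ-commutator subgroup onto the Γ-commutator subgroup. -/
theorem gammaCommutator_le_map {Γ : Type*} [Group Γ] {B G : Type*} [Group B] [Group G]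
    [MulDistribMulAction Γ B] [MulDistribMulAction Γ G] {φ : B →* G}
    (hφ : ∀ (σ : Γ) (b : B), φ (σ • b) = σ • φ b) (hs : Function.Surjective φ) :
    gammaCommutator Γ G ≤ (gammaCommutator Γ B).map φ := by
  conv_lhs => rw [gammaCommutator]
  refine (Subgroup.closure_le _).2 ?_
  rintro x (⟨a, b, rfl⟩ | ⟨σ, g, rfl⟩)
  · obtain ⟨a, rfl⟩ := hs a
    obtain ⟨b, rfl⟩ := hs b
    exact ⟨a * b * a⁻¹ * b⁻¹, Subgroup.subset_closure (Or.inl ⟨a, b, rfl⟩), by simp⟩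
  · obtain ⟨g, rfl⟩ := hs g
    exact ⟨σ • g * g⁻¹, Subgroup.subset_closure (Or.inr ⟨σ, g, rfl⟩), by simp [hφ]⟩

theorem nonempty_universalCentralGammaExtension {Γ : Type u} [Group Γ] {G : Type v} [Group G]
    [MulDistribMulAction Γ G] (h : gammaCommutator Γ G = ⊤) :
    Nonempty (UniversalCentralGammaExtension Γ G) := by
  obtain ⟨B, _, _, φ, hext, hweak⟩ := exists_weaklyUniversalCentralGammaExt Γ G
  have hs : ∀ g, ∃ p ∈ gammaCommutator Γ B, φ p = g := fun g =>
    gammaCommutator_le_map hext.1 hext.2.1 (h ▸ Subgroup.mem_top g)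
  refine ⟨⟨gammaCommutator Γ B, φ.comp (gammaCommutator Γ B).subtype, hext.comp_subtype hs,
    fun X _ _ α hα => ?_⟩⟩
  obtain ⟨f, hf, hαf⟩ := hweak X α hα
  refine ⟨f.comp (gammaCommutator Γ B).subtype, ⟨fun σ u => hf σ u, ?_⟩, fun f' hf' => ?_⟩
  · rw [← MonoidHom.comp_assoc, hαf]
  · have le := gammaCommutator_le_eqLocus hα.2.2.1 hα.2.2.2.1 hf'.1
      (f' := f.comp (gammaCommutator Γ B).subtype) (fun σ u => hf σ u)
      (by rw [hf'.2, ← MonoidHom.comp_assoc, hαf])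
    rw [gammaCommutator_gammaCommutator_eq_top hext.2.2.1 hext.2.2.2.1 hs] at le
    exact MonoidHom.ext fun u => le (Subgroup.mem_top u)

/-- The trivial action of `Γ` on a group. -/
abbrev trivialMulDistribMulAction (Γ A : Type*) [Group Γ] [Group A] : MulDistribMulAction Γ A where
  smul _ a := a
  one_smul _ := rfl
  mul_smul _ _ _ := rfl
  smul_mul _ _ _ := rfl
  smul_one _ := rfl

theorem UniversalCentralGammaExtension.gammaCommutator_eq_top {Γ : Type u} [Group Γ] {G : Type v}
    [Group G] [MulDistribMulAction Γ G] (E : UniversalCentralGammaExtension Γ G) :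
    gammaCommutator Γ G = ⊤ := by
  obtain ⟨U, β, ⟨hβ, hs, -⟩, huniv⟩ := E
  let act := trivialMulDistribMulAction Γ (G ⧸ gammaCommutator Γ G)
  let q := QuotientGroup.mk' (gammaCommutator Γ G)
  have hq : ∀ (σ : Γ) (g : G), q (σ • g) = q g := fun σ g => by
    have : q (σ • g * g⁻¹) = 1 :=
      (QuotientGroup.eq_one_iff _).2 (Subgroup.subset_closure (Or.inr ⟨σ, g, rfl⟩))
    rwa [map_mul, map_inv, mul_inv_eq_one] at this
  have hext : IsCentralGammaExt Γ (MonoidHom.fst G (G ⧸ gammaCommutator Γ G)) := by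
    refine ⟨fun _ _ => rfl, Prod.fst_surjective, ?_, ?_, fun g => (g, 1), fun _ _ => rfl,
      fun _ => rfl⟩
    · rintro ⟨g, a⟩ hg
      obtain rfl : g = 1 := hg
      rw [Subgroup.mem_center_iff]
      rintro ⟨k, b⟩
      simp [mul_comm]
    · rintro σ ⟨g, a⟩ hg
      obtain rfl : g = 1 := hg
      exact Prod.ext (smul_one σ) rfl
  have heq : β.prod 1 = β.prod (q.comp β) :=
    (huniv _ _ hext).unique ⟨fun σ u => Prod.ext (hβ σ u) rfl, MonoidHom.fst_comp_prod _ _⟩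
      ⟨fun σ u => Prod.ext (hβ σ u)
        ((congrArg q (hβ σ u)).trans (hq σ (β u))), MonoidHom.fst_comp_prod _ _⟩
  refine eq_top_iff.2 fun g _ => ?_
  obtain ⟨u, rfl⟩ := hs g
  exact (QuotientGroup.eq_one_iff _).1 (congrArg Prod.snd (DFunLike.congr_fun heq u)).symm

/-- A Γ-group `G` has a universal central Γ-equivariant extension if and
only if `G` is Γ-perfect. -/
theorem exists_universalCentralGammaExtension_iff_gammaPerfect (Γ : Type u) [Group Γ]
    (G : Type v) [Group G] [MulDistribMulAction Γ G] :
    Nonempty (UniversalCentralGammaExtension Γ G) ↔ gammaCommutator Γ G = ⊤ := by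
  exact ⟨fun ⟨E⟩ => E.gammaCommutator_eq_top, nonempty_universalCentralGammaExtension⟩
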